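/- Let a, b, c, d be complex numbers with ab = cd, and let λ be a complex number. Suppose u, v : ℝ → ℂ are twice continuously differentiable functions satisfying −u''(x) + (a·exp(−2πi x) + b·exp(2πi x))·u(x) = λ·u(x) and −v''(x) + (a·exp(−2πi x) + b·exp(2πi x))·v(x) = λ·v(x) for all x ∈ [0,1], with u(0) = 1, u'(0) = 0, v(0) = 0, v'(0) = 1, and suppose U, V : ℝ → ℂ satisfy the analogous equations and initial conditions with the potential c·exp(−2πi x) + d·exp(2πi x). Then u(1) + v'(1) = U(1) + V'(1); that is, the Hill discriminants of the two Mathieu potentials coincide. -/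

import Mathlib

open Real Complex Set

/-- The Mathieu potential `a·exp(−2πi x) + b·exp(2πi x)`. -/
noncomputable def mathieuPot (a b : ℂ) (x : ℝ) : ℂ :=
  a * Complex.exp (-(2 * Real.pi * Complex.I) * (x : ℂ)) +
    b * Complex.exp (2 * Real.pi * Complex.I * (x : ℂ))

/-- The sequence `c` is the coefficient sequence of an everywhere convergent power series. -/
def IsEntireCoeff (c : ℕ → ℂ) : Prop :=
  ∀ ρ : ℝ, 0 ≤ ρ → Summable fun n => ‖c n‖ * ρ ^ n

theorem IsEntireCoeff.summable_norm {c : ℕ → ℂ} (hc : IsEntireCoeff c) (z : ℂ) :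
    Summable fun n => ‖c n * z ^ n‖ := by
  simpa [norm_mul, norm_pow] using hc ‖z‖ (norm_nonneg z)

theorem isEntireCoeff_of_bounded {c : ℕ → ℂ}
    (hc : ∀ ρ : ℝ, 0 ≤ ρ → ∃ B : ℝ, ∀ n, ‖c n‖ * ρ ^ n ≤ B) : IsEntireCoeff c := by
  intro ρ hρ
  obtain ⟨B, hB⟩ := hc (2 * ρ) (by positivity)
  refine Summable.of_nonneg_of_le (fun n => by positivity) (fun n => ?_)
    ((summable_geometric_two).mul_left B)
  calc ‖c n‖ * ρ ^ n = (‖c n‖ * (2 * ρ) ^ n) * (1 / 2) ^ n := by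
        rw [mul_pow, mul_assoc, mul_right_comm ((2 : ℝ) ^ n), ← mul_pow]; norm_num
    _ ≤ B * (1 / 2) ^ n := by gcongr; exact hB n

theorem IsEntireCoeff.deriv {c : ℕ → ℂ} (hc : IsEntireCoeff c) :
    IsEntireCoeff fun n => ((n : ℂ) + 1) * c (n + 1) := by
  intro ρ hρ
  refine Summable.of_nonneg_of_le (fun n => by positivity) (fun n => ?_)
    ((summable_nat_add_iff 1).2 (hc (2 * (ρ + 1)) (by positivity)))
  have h1 : ‖((n : ℂ) + 1)‖ ≤ 2 ^ (n + 1) := by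
    have h2 : ((n + 1 : ℕ) : ℝ) < 2 ^ (n + 1) := by exact_mod_cast Nat.lt_two_pow_self
    have h3 : ‖((n + 1 : ℕ) : ℂ)‖ = ((n + 1 : ℕ) : ℝ) := Complex.norm_natCast _
    push_cast at h2 h3
    linarith
  have h4 : ρ ^ n ≤ (ρ + 1) ^ (n + 1) :=
    (pow_le_pow_left₀ hρ (by linarith) n).trans (pow_le_pow_right₀ (by linarith) (by omega))
  rw [norm_mul, mul_pow]
  calc ‖(n : ℂ) + 1‖ * ‖c (n + 1)‖ * ρ ^ n
      ≤ 2 ^ (n + 1) * ‖c (n + 1)‖ * (ρ + 1) ^ (n + 1) := by gcongr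
    _ = _ := by ring

theorem IsEntireCoeff.hasDerivAt {c : ℕ → ℂ} (hc : IsEntireCoeff c) (z : ℂ) :
    HasDerivAt (fun w => ∑' n, c n * w ^ n) (∑' n : ℕ, ((n : ℂ) + 1) * c (n + 1) * z ^ n) z := by
  have key : HasDerivAt (fun w => ∑' n, c n * w ^ n)
      (∑' n : ℕ, c n * ((n : ℂ) * z ^ (n - 1))) z := by
    refine hasDerivAt_tsum_of_isPreconnected (t := Metric.ball (0 : ℂ) (‖z‖ + 1))
      (y₀ := 0) (g := fun n w => c n * w ^ n) (g' := fun n w => c n * ((n : ℂ) * w ^ (n - 1)))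
      (u := fun n : ℕ => ‖c n * (n * ((‖z‖ + 1 : ℝ) : ℂ) ^ (n - 1))‖) ?_ Metric.isOpen_ball
      Metric.isPreconnected_ball (fun n y _ => ?_) ?_ ?_ ?_ ?_
    · refine (summable_nat_add_iff 1).1 ?_
      refine (hc.deriv.summable_norm ((‖z‖ + 1 : ℝ) : ℂ)).congr fun n => ?_
      congr 1
      push_cast [Nat.add_sub_cancel]
      ring
    · exact (hasDerivAt_pow n y).const_mul (c n)
    · intro n y hy
      have hy' : ‖y‖ ≤ ‖z‖ + 1 := by simpa using (mem_ball_zero_iff.1 hy).le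
      have h0 : 0 ≤ ‖z‖ + 1 := by positivity
      simp only [norm_mul, norm_pow, Complex.norm_real, Real.norm_of_nonneg h0]
      gcongr
    · exact Metric.mem_ball_self (by positivity)
    · exact (hc.summable_norm 0).of_norm
    · exact mem_ball_zero_iff.2 (lt_add_one _)
  convert key using 1
  have hs : Summable fun n => c n * ((n : ℂ) * z ^ (n - 1)) := by
    refine (summable_nat_add_iff 1).1 ?_
    refine (hc.deriv.summable_norm z).of_norm.congr fun n => ?_
    push_cast [Nat.add_sub_cancel]
    ring
  rw [hs.tsum_eq_zero_add]
  simp only [Nat.cast_zero, zero_mul, mul_zero, zero_add]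
  refine tsum_congr fun n => ?_
  push_cast [Nat.add_sub_cancel]
  ring

/-- The Taylor coefficients of the solution of `y'' = (∑ pₖ zᵏ) y`, `y 0 = α`, `y' 0 = β`. -/
noncomputable def odeCoeff (p : ℕ → ℂ) (α β : ℂ) : ℕ → ℂ
  | 0 => α
  | 1 => β
  | n + 2 => (∑ k : Fin (n + 1), odeCoeff p α β k * p (n - k)) / (((n : ℂ) + 1) * ((n : ℂ) + 2))
  decreasing_by exact Nat.lt_succ_of_lt k.2

theorem odeCoeff_add_two (p : ℕ → ℂ) (α β : ℂ) (n : ℕ) :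
    ((n : ℂ) + 1) * ((n + 1 : ℂ) + 1) * odeCoeff p α β (n + 2) =
      ∑ k ∈ Finset.range (n + 1), odeCoeff p α β k * p (n - k) := by
  have h1 : (n : ℂ) + 1 ≠ 0 := by exact_mod_cast Nat.succ_ne_zero n
  have h2 : (n : ℂ) + 2 ≠ 0 := by exact_mod_cast Nat.succ_ne_zero (n + 1)
  rw [odeCoeff, Finset.sum_range]
  field_simp
  ring

theorem isEntireCoeff_odeCoeff {p : ℕ → ℂ} (hp : IsEntireCoeff p) (α β : ℂ) :
    IsEntireCoeff (odeCoeff p α β) := by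
  refine isEntireCoeff_of_bounded fun ρ hρ => ?_
  set c := odeCoeff p α β with hcdef
  set Q : ℝ := ∑' n, ‖p n‖ * ρ ^ n with hQ
  obtain ⟨N, hN⟩ := exists_nat_ge (ρ ^ 2 * Q)
  set B : ℝ := ∑ j ∈ Finset.range (N + 2), ‖c j‖ * ρ ^ j with hB
  have hB0 : 0 ≤ B := Finset.sum_nonneg fun j _ => by positivity
  refine ⟨B, fun n => ?_⟩
  induction n using Nat.strong_induction_on with
  | _ n ih =>
  by_cases hn : n < N + 2
  · exact Finset.single_le_sum (f := fun j => ‖c j‖ * ρ ^ j) (fun j _ => by positivity)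
      (Finset.mem_range.2 hn)
  obtain ⟨m, rfl⟩ : ∃ m, n = m + 2 := ⟨n - 2, by omega⟩
  have hm : (N : ℝ) ≤ m := by exact_mod_cast (by omega : N ≤ m)
  have hm0 : (0 : ℝ) ≤ m := Nat.cast_nonneg m
  have hrec := congrArg norm (odeCoeff_add_two p α β m)
  have e1 : ‖(m : ℂ) + 1‖ = m + 1 := by exact_mod_cast Complex.norm_natCast (m + 1)
  have e2 : ‖(m + 1 : ℂ) + 1‖ = m + 1 + 1 := by exact_mod_cast Complex.norm_natCast (m + 1 + 1)
  rw [norm_mul, norm_mul, e1, e2, ← hcdef] at hrec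
  have hsum : ‖∑ k ∈ Finset.range (m + 1), c k * p (m - k)‖ * ρ ^ m ≤ B * Q := by
    calc _ ≤ (∑ k ∈ Finset.range (m + 1), ‖c k * p (m - k)‖) * ρ ^ m := by
          gcongr; exact norm_sum_le _ _
      _ = ∑ k ∈ Finset.range (m + 1), (‖c k‖ * ρ ^ k) * (‖p (m - k)‖ * ρ ^ (m - k)) := by
          rw [Finset.sum_mul]
          refine Finset.sum_congr rfl fun k hk => ?_
          have hk' : k + (m - k) = m := by have := Finset.mem_range.1 hk; omega
          conv_lhs => rw [← hk', pow_add, hk']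
          rw [norm_mul]; ring
      _ ≤ ∑ k ∈ Finset.range (m + 1), B * (‖p (m - k)‖ * ρ ^ (m - k)) := by
          refine Finset.sum_le_sum fun k hk => ?_
          gcongr
          exact ih k (by have := Finset.mem_range.1 hk; omega)
      _ = B * ∑ k ∈ Finset.range (m + 1), ‖p k‖ * ρ ^ k := by
          rw [← Finset.mul_sum, ← Finset.sum_range_reflect (fun k => ‖p k‖ * ρ ^ k) (m + 1)]
          simp only [Nat.add_sub_cancel]
      _ ≤ B * Q := by
          gcongr
          exact (hp ρ hρ).sum_le_tsum _ fun k _ => by positivity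
  rw [← hrec] at hsum
  have hfin : ((m + 1 : ℝ) * (m + 1 + 1)) * (‖c (m + 2)‖ * ρ ^ (m + 2)) ≤
      ((m + 1 : ℝ) * (m + 1 + 1)) * B := by
    calc _ = ρ ^ 2 * ((m + 1 : ℝ) * (m + 1 + 1) * ‖c (m + 2)‖ * ρ ^ m) := by ring
      _ ≤ ρ ^ 2 * (B * Q) := by gcongr
      _ = (ρ ^ 2 * Q) * B := by ring
      _ ≤ ((m + 1 : ℝ) * (m + 1 + 1)) * B := by
          refine mul_le_mul_of_nonneg_right ?_ hB0
          nlinarith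
  exact le_of_mul_le_mul_left hfin (by positivity)

/-- `(y, y')` is an entire solution of `y'' = P y`, written as a first-order system. -/
structure IsEntireSol (P : ℂ → ℂ) (y dy : ℂ → ℂ) : Prop where
  hasDerivAt : ∀ z, HasDerivAt y (dy z) z
  hasDerivAt_deriv : ∀ z, HasDerivAt dy (P z * y z) z

theorem exists_isEntireSol {p : ℕ → ℂ} (hp : IsEntireCoeff p) (α β : ℂ) :
    ∃ y dy : ℂ → ℂ, IsEntireSol (fun z => ∑' n, p n * z ^ n) y dy ∧ y 0 = α ∧ dy 0 = β := by
  have hc := isEntireCoeff_odeCoeff hp α β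
  refine ⟨fun z => ∑' n, odeCoeff p α β n * z ^ n,
    fun z => ∑' n : ℕ, ((n : ℂ) + 1) * odeCoeff p α β (n + 1) * z ^ n,
    ⟨hc.hasDerivAt, fun z => ?_⟩, ?_, ?_⟩
  · convert hc.deriv.hasDerivAt z using 1
    rw [mul_comm, tsum_mul_tsum_eq_tsum_sum_antidiagonal_of_summable_norm
      (hc.summable_norm z) (hp.summable_norm z)]
    refine tsum_congr fun n => ?_
    rw [Finset.Nat.sum_antidiagonal_eq_sum_range_succ
      (fun i j => odeCoeff p α β i * z ^ i * (p j * z ^ j))]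
    push_cast
    rw [← mul_assoc, odeCoeff_add_two, Finset.sum_mul]
    refine Finset.sum_congr rfl fun k hk => ?_
    have hk' : k + (n - k) = n := by have := Finset.mem_range.1 hk; omega
    conv_rhs => rw [← hk', pow_add, hk']
    ring
  · simp only []
    rw [tsum_eq_single 0 fun n hn => by simp [hn]]
    simp [odeCoeff]
  · simp only []
    rw [tsum_eq_single 0 fun n hn => by simp [hn]]
    simp [odeCoeff]

theorem norm_le_of_linear_system {f g f' g' : ℝ → ℂ} {K ε : ℝ} (hK : 1 ≤ K) (hε : 0 ≤ ε)
    (hf : ∀ s ∈ Set.Icc (0 : ℝ) 1, HasDerivAt f (f' s) s)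
    (hg : ∀ s ∈ Set.Icc (0 : ℝ) 1, HasDerivAt g (g' s) s) (hf0 : f 0 = 0) (hg0 : g 0 = 0)
    (hf' : ∀ s ∈ Set.Icc (0 : ℝ) 1, ‖f' s‖ ≤ K * ‖g s‖)
    (hg' : ∀ s ∈ Set.Icc (0 : ℝ) 1, ‖g' s‖ ≤ K * ‖f s‖ + ε) :
    ‖f 1‖ ≤ ε * Real.exp K ∧ ‖g 1‖ ≤ ε * Real.exp K := by
  have hd : ∀ s ∈ Set.Icc (0 : ℝ) 1, HasDerivAt (fun s => (f s, g s)) (f' s, g' s) s :=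
    fun s hs => (hf s hs).prodMk (hg s hs)
  have key := norm_le_gronwallBound_of_norm_deriv_right_le (f := fun s => (f s, g s))
    (f' := fun s => (f' s, g' s)) (δ := 0) (K := K) (ε := ε) (a := 0) (b := 1)
    (fun s hs => (hd s hs).continuousAt.continuousWithinAt)
    (fun s hs => (hd s (Set.Ico_subset_Icc_self hs)).hasDerivWithinAt)
    (by simp [hf0, hg0]) (fun s hs => ?_) 1 (by simp)
  · rw [gronwallBound_of_K_ne_0 (by linarith)] at key
    have hle : 0 * Real.exp (K * (1 - 0)) + ε / K * (Real.exp (K * (1 - 0)) - 1) ≤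
        ε * Real.exp K := by
      have h1 : ε / K ≤ ε := div_le_self hε hK
      have h2 : 0 ≤ Real.exp K := (Real.exp_pos K).le
      have h3 : 0 ≤ ε / K := by positivity
      simp only [sub_zero, mul_one, zero_mul, zero_add]
      nlinarith
    exact ⟨(norm_fst_le (f 1, g 1)).trans (key.trans hle),
      (norm_snd_le (f 1, g 1)).trans (key.trans hle)⟩
  · have hs' := Set.Ico_subset_Icc_self hs
    have h1 : ‖f s‖ ≤ ‖(f s, g s)‖ := norm_fst_le (f s, g s)
    have h2 : ‖g s‖ ≤ ‖(f s, g s)‖ := norm_snd_le (f s, g s)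
    refine norm_prod_le_iff.2 ⟨?_, ?_⟩
    · have := hf' s hs'
      have := mul_le_mul_of_nonneg_left h2 (zero_le_one.trans hK)
      simp only
      linarith
    · have := hg' s hs'
      have := mul_le_mul_of_nonneg_left h1 (zero_le_one.trans hK)
      simp only
      linarith

theorem hasDerivAt_ray {F F' : ℂ → ℂ} (hF : ∀ w, HasDerivAt F (F' w) w) (z : ℂ) (s : ℝ) :
    HasDerivAt (fun s : ℝ => F (s * z)) (z * F' (s * z)) s := by
  have h1 : HasDerivAt (fun s : ℂ => s * z) z (s : ℂ) := by
    simpa using (hasDerivAt_id (s : ℂ)).mul_const z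
  have h2 := ((hF ((s : ℂ) * z)).comp (s : ℂ) h1).comp_ofReal
  rw [mul_comm]
  exact h2

namespace IsEntireSol

variable {P : ℂ → ℂ} {y dy y₁ dy₁ y₂ dy₂ : ℂ → ℂ}

theorem linearComb (h₁ : IsEntireSol P y₁ dy₁) (h₂ : IsEntireSol P y₂ dy₂) (α β : ℂ) :
    IsEntireSol P (fun z => α * y₁ z + β * y₂ z) (fun z => α * dy₁ z + β * dy₂ z) where
  hasDerivAt z := ((h₁.hasDerivAt z).const_mul α).add ((h₂.hasDerivAt z).const_mul β)
  hasDerivAt_deriv z :=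
    (((h₁.hasDerivAt_deriv z).const_mul α).add ((h₂.hasDerivAt_deriv z).const_mul β)).congr_deriv
      (by ring)

theorem translate (h : IsEntireSol P y dy) (τ : ℂ) :
    IsEntireSol (fun z => P (z + τ)) (fun z => y (z + τ)) (fun z => dy (z + τ)) where
  hasDerivAt z := (h.hasDerivAt (z + τ)).comp_add_const z τ
  hasDerivAt_deriv z := (h.hasDerivAt_deriv (z + τ)).comp_add_const z τ

theorem eq_zero (hP : Continuous P) (h : IsEntireSol P y dy) (h0 : y 0 = 0) (h0' : dy 0 = 0)
    (z : ℂ) : y z = 0 ∧ dy z = 0 := by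
  obtain ⟨M, hM⟩ := isCompact_Icc.exists_bound_of_continuousOn (s := Set.Icc (0 : ℝ) 1)
    (f := fun s : ℝ => z * P (s * z)) (by fun_prop)
  have key := norm_le_of_linear_system (K := 1 + ‖z‖ + M) (ε := 0)
    (by have := (norm_nonneg _).trans (hM 0 (by simp)); have := norm_nonneg z; linarith) le_rfl
    (fun s _ => hasDerivAt_ray h.hasDerivAt z s)
    (fun s _ => hasDerivAt_ray h.hasDerivAt_deriv z s) (by simpa using h0) (by simpa using h0')
    (fun s hs => ?_) (fun s hs => ?_)
  · simpa using key
  · rw [norm_mul]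
    gcongr
    have := (norm_nonneg _).trans (hM 0 (by simp))
    linarith
  · rw [← mul_assoc, norm_mul, add_zero]
    gcongr
    have := hM s hs
    have := norm_nonneg z
    linarith

theorem eq_fundamental (hP : Continuous P) (h : IsEntireSol P y dy)
    (h₁ : IsEntireSol P y₁ dy₁) (h₂ : IsEntireSol P y₂ dy₂)
    (h10 : y₁ 0 = 1) (h10' : dy₁ 0 = 0) (h20 : y₂ 0 = 0) (h20' : dy₂ 0 = 1) (z : ℂ) :
    y z = y 0 * y₁ z + dy 0 * y₂ z ∧ dy z = y 0 * dy₁ z + dy 0 * dy₂ z := by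
  have key := ((h₁.linearComb h₂ (y 0) (dy 0)).linearComb h (-1) 1).eq_zero hP
    (by simp [h10, h20]) (by simp [h10', h20']) z
  constructor
  · linear_combination key.1
  · linear_combination key.2

theorem wronskian_eq (h₁ : IsEntireSol P y₁ dy₁) (h₂ : IsEntireSol P y₂ dy₂) (z : ℂ) :
    y₁ z * dy₂ z - dy₁ z * y₂ z = y₁ 0 * dy₂ 0 - dy₁ 0 * y₂ 0 := by
  have hd : ∀ w, HasDerivAt (fun w => y₁ w * dy₂ w - dy₁ w * y₂ w) 0 w := fun w =>
    (((h₁.hasDerivAt w).mul (h₂.hasDerivAt_deriv w)).sub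
      ((h₁.hasDerivAt_deriv w).mul (h₂.hasDerivAt w))).congr_deriv (by ring)
  exact is_const_of_deriv_eq_zero (fun w => (hd w).differentiableAt) (fun w => (hd w).deriv) z 0

theorem eq_on_real (hP : Continuous P) (h : IsEntireSol P y dy) {u : ℝ → ℂ}
    (hu : ContDiff ℝ 2 u) (hueq : ∀ x ∈ Set.Icc (0 : ℝ) 1, deriv (deriv u) x = P x * u x)
    (h0 : u 0 = y 0) (h0' : deriv u 0 = dy 0) : u 1 = y 1 ∧ deriv u 1 = dy 1 := by
  have hu1 : ContDiff ℝ 1 (deriv u) :=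
    ((contDiff_succ_iff_deriv (n := 1)).1 (by simpa [one_add_one_eq_two] using hu)).2.2
  have hud : ∀ x, HasDerivAt u (deriv u x) x :=
    fun x => (hu.differentiable (by norm_num) x).hasDerivAt
  have hud' : ∀ x, HasDerivAt (deriv u) (deriv (deriv u) x) x :=
    fun x => (hu1.differentiable (by norm_num) x).hasDerivAt
  obtain ⟨M, hM⟩ := isCompact_Icc.exists_bound_of_continuousOn (s := Set.Icc (0 : ℝ) 1)
    (f := fun s : ℝ => P s) (by fun_prop)
  have hM0 := (norm_nonneg _).trans (hM 0 (by simp))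
  have key := norm_le_of_linear_system (K := 1 + M) (ε := 0) (by linarith) le_rfl
    (fun s _ => (hud s).sub (h.hasDerivAt (s : ℂ)).comp_ofReal)
    (fun s _ => (hud' s).sub (h.hasDerivAt_deriv (s : ℂ)).comp_ofReal)
    (by simp [h0]) (by simp [h0']) (fun s hs => ?_) (fun s hs => ?_)
  · simpa [sub_eq_zero] using key
  · simp only [Pi.sub_apply]
    nlinarith [norm_nonneg (deriv u s - dy s)]
  · rw [hueq s hs, ← mul_sub, norm_mul, add_zero]
    simp only [Pi.sub_apply]
    gcongr
    linarith [hM s hs]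

end IsEntireSol

/-- `Δ` is the trace of the monodromy matrix over `[0, 1]` of the entire equation `y'' = P y`. -/
def IsDiscriminant (P : ℂ → ℂ) (Δ : ℂ) : Prop :=
  ∃ φ dφ ψ dψ : ℂ → ℂ, IsEntireSol P φ dφ ∧ IsEntireSol P ψ dψ ∧
    φ 0 = 1 ∧ dφ 0 = 0 ∧ ψ 0 = 0 ∧ dψ 0 = 1 ∧ Δ = φ 1 + dψ 1

theorem IsDiscriminant.eq_of_translate {P : ℂ → ℂ} (hP : Continuous P)
    (hper : ∀ z, P (z + 1) = P z) (τ : ℂ) {Δ Δ' : ℂ} (hΔ : IsDiscriminant P Δ)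
    (hΔ' : IsDiscriminant (fun z => P (z + τ)) Δ') : Δ = Δ' := by
  obtain ⟨φ, dφ, ψ, dψ, hφ, hψ, hφ0, hφ0', hψ0, hψ0', rfl⟩ := hΔ
  obtain ⟨φ', dφ', ψ', dψ', hφ', hψ', hφ'0, hφ'0', hψ'0, hψ'0', rfl⟩ := hΔ'
  have hPτ : Continuous fun z => P (z + τ) := by fun_prop
  have hshift : ∀ {y dy : ℂ → ℂ}, IsEntireSol P y dy →
      IsEntireSol P (fun z => y (z + 1)) (fun z => dy (z + 1)) := fun h => by
    simpa only [hper] using h.translate 1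
  obtain ⟨e1, e2⟩ := (hshift hφ).eq_fundamental hP hφ hψ hφ0 hφ0' hψ0 hψ0' τ
  obtain ⟨e3, e4⟩ := (hshift hψ).eq_fundamental hP hφ hψ hφ0 hφ0' hψ0 hψ0' τ
  obtain ⟨e5, e6⟩ := (hφ.translate τ).eq_fundamental hPτ hφ' hψ' hφ'0 hφ'0' hψ'0 hψ'0' 1
  obtain ⟨e7, e8⟩ := (hψ.translate τ).eq_fundamental hPτ hφ' hψ' hφ'0 hφ'0' hψ'0 hψ'0' 1
  have hW := hφ.wronskian_eq hψ τ
  rw [hφ0, hφ0', hψ0, hψ0'] at hW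
  simp only [zero_add, add_comm (1 : ℂ) τ] at e1 e2 e3 e4 e5 e6 e7 e8
  rw [e5] at e1
  rw [e6] at e2
  rw [e7] at e3
  rw [e8] at e4
  linear_combination (-dψ τ) * e1 + ψ τ * e2 + dφ τ * e3 - φ τ * e4 +
    (φ' 1 + dψ' 1 - φ 1 - dψ 1) * hW

/-- The coefficient `q - λ` of the Mathieu equation, on the complex plane. -/
noncomputable def mathieuCoeff (a b lam z : ℂ) : ℂ :=
  a * Complex.exp (-(2 * Real.pi * Complex.I) * z) + b * Complex.exp (2 * Real.pi * Complex.I * z)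
    - lam

theorem continuous_mathieuCoeff (a b lam : ℂ) : Continuous (mathieuCoeff a b lam) := by
  unfold mathieuCoeff
  fun_prop

theorem mathieuCoeff_add_one (a b lam z : ℂ) :
    mathieuCoeff a b lam (z + 1) = mathieuCoeff a b lam z := by
  simp only [mathieuCoeff, mul_add, Complex.exp_add, mul_one, Complex.exp_neg,
    Complex.exp_two_pi_mul_I, inv_one]

theorem isEntireCoeff_exp (w : ℂ) : IsEntireCoeff fun n => w ^ n / (n.factorial : ℂ) := by
  intro ρ hρ
  refine (Real.summable_pow_div_factorial (‖w‖ * ρ)).congr fun n => ?_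
  rw [norm_div, norm_pow, Complex.norm_natCast, mul_pow]
  ring

theorem exists_mathieuCoeff_eq_tsum (a b lam : ℂ) :
    ∃ p, IsEntireCoeff p ∧ mathieuCoeff a b lam = fun z => ∑' n, p n * z ^ n := by
  set w : ℂ := 2 * Real.pi * Complex.I with hw
  have hexp : ∀ v z : ℂ, HasSum (fun n => v ^ n / (n.factorial : ℂ) * z ^ n)
      (Complex.exp (v * z)) := fun v z => by
    rw [Complex.exp_eq_exp_ℂ]
    refine (NormedSpace.expSeries_div_hasSum_exp (v * z)).congr_fun fun n => ?_
    rw [mul_pow]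
    ring
  refine ⟨fun n => a * ((-w) ^ n / (n.factorial : ℂ)) + b * (w ^ n / (n.factorial : ℂ)) -
    (if n = 0 then lam else 0), fun ρ hρ => ?_, funext fun z => ?_⟩
  · have h0 : Summable fun n : ℕ => (if n = 0 then ‖lam‖ else 0) * ρ ^ n :=
      summable_of_ne_finset_zero (s := {0}) fun n hn => by simp at hn; simp [hn]
    refine Summable.of_nonneg_of_le (fun n => by positivity) (fun n => ?_)
      ((((isEntireCoeff_exp (-w) ρ hρ).mul_left ‖a‖).add
        ((isEntireCoeff_exp w ρ hρ).mul_left ‖b‖)).add h0)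
    rw [← mul_assoc, ← mul_assoc, ← add_mul, ← add_mul, ← norm_mul, ← norm_mul]
    gcongr
    refine (norm_sub_le _ _).trans (add_le_add (norm_add_le _ _) ?_)
    split_ifs <;> simp
  · have h0 : HasSum (fun n : ℕ => (if n = 0 then lam else 0) * z ^ n) lam := by
      convert hasSum_ite_eq (0 : ℕ) lam using 2 with n
      split_ifs with hn <;> simp [hn]
    have := (((hexp (-w) z).mul_left a).add ((hexp w z).mul_left b)).sub h0
    rw [mathieuCoeff, ← hw, ← this.tsum_eq]
    refine tsum_congr fun n => ?_
    ring

theorem exists_isDiscriminant (a b lam : ℂ) : ∃ Δ, IsDiscriminant (mathieuCoeff a b lam) Δ := by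
  obtain ⟨p, hp, hpeq⟩ := exists_mathieuCoeff_eq_tsum a b lam
  rw [hpeq]
  obtain ⟨φ, dφ, hφ, hφ0, hφ0'⟩ := exists_isEntireSol hp 1 0
  obtain ⟨ψ, dψ, hψ, hψ0, hψ0'⟩ := exists_isEntireSol hp 0 1
  exact ⟨_, φ, dφ, ψ, dψ, hφ, hψ, hφ0, hφ0', hψ0, hψ0', rfl⟩

theorem isDiscriminant_scale {a b lam s Δ Δ' : ℂ} (hs : s ≠ 0)
    (hΔ : IsDiscriminant (mathieuCoeff a b lam) Δ)
    (hΔ' : IsDiscriminant (mathieuCoeff (s * a) (s⁻¹ * b) lam) Δ') : Δ = Δ' := by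
  set w : ℂ := 2 * Real.pi * Complex.I with hw
  have hw0 : w ≠ 0 := Complex.two_pi_I_ne_zero
  refine hΔ.eq_of_translate (continuous_mathieuCoeff a b lam) (mathieuCoeff_add_one a b lam)
    (-(Complex.log s / w)) ?_
  convert hΔ' using 1
  funext z
  have h1 : w * -(Complex.log s / w) = -Complex.log s := by field_simp
  simp only [mathieuCoeff, ← hw, mul_add, Complex.exp_add, neg_mul w (-(Complex.log s / w)), h1,
    neg_neg, Complex.exp_neg (Complex.log s), Complex.exp_log hs]
  ring

theorem norm_mathieuCoeff_le (a b lam : ℂ) (x : ℝ) :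
    ‖mathieuCoeff a b lam x‖ ≤ ‖a‖ + ‖b‖ + ‖lam‖ := by
  have h1 : ‖Complex.exp (-(2 * Real.pi * Complex.I) * x)‖ = 1 := by
    rw [Complex.norm_exp]; simp
  have h2 : ‖Complex.exp (2 * Real.pi * Complex.I * x)‖ = 1 := by
    rw [Complex.norm_exp]; simp
  refine (norm_sub_le _ _).trans (add_le_add_left ((norm_add_le _ _).trans ?_) _)
  rw [norm_mul, norm_mul, h1, h2, mul_one, mul_one]

theorem norm_sub_le_of_isEntireSol {a b lam : ℂ} {y dy : ℂ → ℂ}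
    (h : IsEntireSol (mathieuCoeff 0 0 lam) y dy) :
    ∃ C : ℝ, ∀ t : ℝ, 0 < t → t ≤ 1 → ∀ y' dy' : ℂ → ℂ,
      IsEntireSol (mathieuCoeff (t * a) (t * b) lam) y' dy' → y' 0 = y 0 → dy' 0 = dy 0 →
      ‖y' 1 - y 1‖ ≤ t * C ∧ ‖dy' 1 - dy 1‖ ≤ t * C := by
  have hyc : Continuous y := continuous_iff_continuousAt.2 fun z => (h.hasDerivAt z).continuousAt
  obtain ⟨M, hM⟩ := isCompact_Icc.exists_bound_of_continuousOn (s := Set.Icc (0 : ℝ) 1)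
    (f := fun s : ℝ => y s) (by fun_prop)
  have hM0 := (norm_nonneg _).trans (hM 0 (by simp))
  refine ⟨(‖a‖ + ‖b‖) * M * Real.exp (1 + ‖a‖ + ‖b‖ + ‖lam‖), fun t ht ht1 y' dy' h' h0 h0' => ?_⟩
  have hta : ‖(t : ℂ) * a‖ = t * ‖a‖ := by
    rw [norm_mul, Complex.norm_real, Real.norm_of_nonneg ht.le]
  have htb : ‖(t : ℂ) * b‖ = t * ‖b‖ := by
    rw [norm_mul, Complex.norm_real, Real.norm_of_nonneg ht.le]
  have ha := norm_nonneg a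
  have hb := norm_nonneg b
  have hl := norm_nonneg lam
  rw [← mul_assoc]
  refine norm_le_of_linear_system (f := fun s : ℝ => y' s - y s) (g := fun s : ℝ => dy' s - dy s)
    (K := 1 + ‖a‖ + ‖b‖ + ‖lam‖) (ε := t * ((‖a‖ + ‖b‖) * M)) (by linarith) (by positivity)
    (fun s _ => (h'.hasDerivAt s).comp_ofReal.sub (h.hasDerivAt s).comp_ofReal)
    (fun s _ => (h'.hasDerivAt_deriv s).comp_ofReal.sub (h.hasDerivAt_deriv s).comp_ofReal)
    (by simp [h0]) (by simp [h0']) (fun s hs => ?_) (fun s hs => ?_)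
  · nlinarith [norm_nonneg (dy' s - dy s)]
  · have e : mathieuCoeff (t * a) (t * b) lam s * y' s - mathieuCoeff 0 0 lam s * y s =
        mathieuCoeff (t * a) (t * b) lam s * (y' s - y s) +
          mathieuCoeff (t * a) (t * b) 0 s * y s := by
      simp only [mathieuCoeff]; ring
    rw [e]
    refine (norm_add_le _ _).trans ?_
    rw [norm_mul, norm_mul]
    have h1 := norm_mathieuCoeff_le (t * a) (t * b) lam s
    have h2 := norm_mathieuCoeff_le (t * a) (t * b) 0 s
    rw [hta, htb] at h1 h2
    rw [norm_zero, add_zero, ← mul_add] at h2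
    have h3 : t * ‖a‖ ≤ ‖a‖ := mul_le_of_le_one_left ha ht1
    have h4 : t * ‖b‖ ≤ ‖b‖ := mul_le_of_le_one_left hb ht1
    rw [← mul_assoc]
    gcongr
    · linarith
    · exact hM s hs

theorem isDiscriminant_eq_free {a b lam Δ Δ₀ : ℂ} (hab : a * b = 0)
    (hΔ : IsDiscriminant (mathieuCoeff a b lam) Δ)
    (hΔ₀ : IsDiscriminant (mathieuCoeff 0 0 lam) Δ₀) : Δ = Δ₀ := by
  obtain ⟨φ, dφ, ψ, dψ, hφ, hψ, hφ0, hφ0', hψ0, hψ0', rfl⟩ := hΔ₀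
  obtain ⟨C, hC⟩ := norm_sub_le_of_isEntireSol (a := a) (b := b) hφ
  obtain ⟨C', hC'⟩ := norm_sub_le_of_isEntireSol (a := a) (b := b) hψ
  have key : ∀ t : ℝ, 0 < t → t ≤ 1 → ‖Δ - (φ 1 + dψ 1)‖ ≤ t * (C + C') := by
    intro t ht ht1
    obtain ⟨Δ', hΔ'⟩ := exists_isDiscriminant (t * a) (t * b) lam
    have ht0 : (t : ℂ) ≠ 0 := by exact_mod_cast ht.ne'
    have hΔΔ' : Δ = Δ' := by
      rcases mul_eq_zero.1 hab with rfl | rfl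
      · exact isDiscriminant_scale (inv_ne_zero ht0) hΔ (by simpa using hΔ')
      · exact isDiscriminant_scale ht0 hΔ (by simpa using hΔ')
    obtain ⟨φ', dφ', ψ', dψ', hφ', hψ', hφ'0, hφ'0', hψ'0, hψ'0', rfl⟩ := hΔ'
    have h1 := (hC t ht ht1 φ' dφ' hφ' (hφ'0.trans hφ0.symm) (hφ'0'.trans hφ0'.symm)).1
    have h2 := (hC' t ht ht1 ψ' dψ' hψ' (hψ'0.trans hψ0.symm) (hψ'0'.trans hψ0'.symm)).2
    rw [hΔΔ', add_sub_add_comm, mul_add]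
    exact (norm_add_le _ _).trans (add_le_add h1 h2)
  have hlim : Filter.Tendsto (fun t : ℝ => t * (C + C')) (nhdsWithin 0 (Set.Ioi 0)) (nhds 0) := by
    have : Continuous fun t : ℝ => t * (C + C') := by fun_prop
    simpa using (this.tendsto 0).mono_left nhdsWithin_le_nhds
  have hle : ‖Δ - (φ 1 + dψ 1)‖ ≤ 0 := by
    refine ge_of_tendsto hlim ?_
    filter_upwards [Ioc_mem_nhdsGT (zero_lt_one' ℝ)] with t ht using key t ht.1 ht.2
  exact sub_eq_zero.1 (norm_le_zero_iff.1 hle)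

theorem isDiscriminant_eq_of_mul_eq {a b c d lam Δ Δ' : ℂ} (h : a * b = c * d)
    (hΔ : IsDiscriminant (mathieuCoeff a b lam) Δ)
    (hΔ' : IsDiscriminant (mathieuCoeff c d lam) Δ') : Δ = Δ' := by
  by_cases hab : a * b = 0
  · obtain ⟨Δ₀, hΔ₀⟩ := exists_isDiscriminant 0 0 lam
    exact (isDiscriminant_eq_free hab hΔ hΔ₀).trans
      (isDiscriminant_eq_free (h ▸ hab) hΔ' hΔ₀).symm
  · have ha : a ≠ 0 := left_ne_zero_of_mul hab
    have hc : c ≠ 0 := left_ne_zero_of_mul (h ▸ hab)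
    refine isDiscriminant_scale (s := c / a) (div_ne_zero hc ha) hΔ ?_
    convert hΔ' using 2
    · field_simp
    · rw [inv_div]
      field_simp
      exact h

theorem isDiscriminant_of_real_solutions {a b lam : ℂ} {u v : ℝ → ℂ}
    (hu : ContDiff ℝ 2 u) (hv : ContDiff ℝ 2 v)
    (hueq : ∀ x ∈ Set.Icc (0 : ℝ) 1, -(deriv (deriv u) x) + mathieuPot a b x * u x = lam * u x)
    (hveq : ∀ x ∈ Set.Icc (0 : ℝ) 1, -(deriv (deriv v) x) + mathieuPot a b x * v x = lam * v x)
    (hu0 : u 0 = 1) (hu0' : deriv u 0 = 0) (hv0 : v 0 = 0) (hv0' : deriv v 0 = 1) :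
    IsDiscriminant (mathieuCoeff a b lam) (u 1 + deriv v 1) := by
  obtain ⟨Δ, φ, dφ, ψ, dψ, hφ, hψ, hφ0, hφ0', hψ0, hψ0', hΔ⟩ := exists_isDiscriminant a b lam
  have hpot : ∀ x : ℝ, mathieuCoeff a b lam x = mathieuPot a b x - lam := fun x => rfl
  have h1 := hφ.eq_on_real (continuous_mathieuCoeff a b lam) hu
    (fun x hx => by rw [hpot]; linear_combination -(hueq x hx)) (hu0.trans hφ0.symm)
    (hu0'.trans hφ0'.symm)
  have h2 := hψ.eq_on_real (continuous_mathieuCoeff a b lam) hv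
    (fun x hx => by rw [hpot]; linear_combination -(hveq x hx)) (hv0.trans hψ0.symm)
    (hv0'.trans hψ0'.symm)
  exact ⟨φ, dφ, ψ, dψ, hφ, hψ, hφ0, hφ0', hψ0, hψ0', by rw [h1.1, h2.2]⟩

theorem hill_discriminants_coincide (a b c d : ℂ) (h : a * b = c * d) (lam : ℂ)
    (u v U V : ℝ → ℂ)
    (hu : ContDiff ℝ 2 u) (hv : ContDiff ℝ 2 v)
    (hU : ContDiff ℝ 2 U) (hV : ContDiff ℝ 2 V)
    (hueq : ∀ x ∈ Set.Icc (0:ℝ) 1,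
      -(deriv (deriv u) x) + mathieuPot a b x * u x = lam * u x)
    (hveq : ∀ x ∈ Set.Icc (0:ℝ) 1,
      -(deriv (deriv v) x) + mathieuPot a b x * v x = lam * v x)
    (hUeq : ∀ x ∈ Set.Icc (0:ℝ) 1,
      -(deriv (deriv U) x) + mathieuPot c d x * U x = lam * U x)
    (hVeq : ∀ x ∈ Set.Icc (0:ℝ) 1,
      -(deriv (deriv V) x) + mathieuPot c d x * V x = lam * V x)
    (hu0 : u 0 = 1) (hu0' : deriv u 0 = 0)
    (hv0 : v 0 = 0) (hv0' : deriv v 0 = 1)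
    (hU0 : U 0 = 1) (hU0' : deriv U 0 = 0)
    (hV0 : V 0 = 0) (hV0' : deriv V 0 = 1) :
    u 1 + deriv v 1 = U 1 + deriv V 1 := by
  exact isDiscriminant_eq_of_mul_eq h
    (isDiscriminant_of_real_solutions hu hv hueq hveq hu0 hu0' hv0 hv0')
    (isDiscriminant_of_real_solutions hU hV hUeq hVeq hU0 hU0' hV0 hV0')
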